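/- Let y ∼ N(X_T β_T, I_n) in ℝ^n, let F, T ⊂ {1,…,p} be index sets of size k with X_F, X_T full column rank, define Z = yᵀ(Π_F − Π_T)y and d = |T − F|. Then inf over t with |t| < 1/2 of log E[e^{Zt}] is at most d/2 − ((3 − 2√2)/2) · ‖(I − Π_F) X_{T−F} β_{T−F}‖². -/

import Mathlib

open MeasureTheory ProbabilityTheory Matrix

noncomputable section

/-- The submatrix of `X` consisting of the columns indexed by `F`. -/
def colSub {n p : ℕ} (X : Matrix (Fin n) (Fin p) ℝ) (F : Finset (Fin p)) :
    Matrix (Fin n) {j // j ∈ F} ℝ :=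
  X.submatrix id (fun j => (j : Fin p))

/-- `Π_F = X_F (X_Fᵀ X_F)⁻¹ X_Fᵀ`, the orthogonal projection onto the column
space of `X_F` (when `X_F` has full column rank). -/
def proj {n p : ℕ} (X : Matrix (Fin n) (Fin p) ℝ) (F : Finset (Fin p)) :
    Matrix (Fin n) (Fin n) ℝ :=
  colSub X F * ((colSub X F)ᵀ * colSub X F)⁻¹ * (colSub X F)ᵀ

/-- The vector `β` with all entries outside `S` replaced by `0`; thus
`X.mulVec (restr β S) = X_S β_S`. -/
def restr {p : ℕ} (β : Fin p → ℝ) (S : Finset (Fin p)) : Fin p → ℝ :=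
  fun i => if i ∈ S then β i else 0

/-- Squared Euclidean norm. -/
def sqnorm {n : ℕ} (v : Fin n → ℝ) : ℝ := ∑ i, (v i) ^ 2

/-- The law of a standard Gaussian vector `ε ∼ N(0, I_n)` on `ℝ^n`. -/
def stdGaussian (n : ℕ) : Measure (Fin n → ℝ) :=
  Measure.pi fun _ => gaussianReal 0 1

theorem integral_exp_mul_sq_gaussianReal (a m : ℝ) (ha : a < 1 / 2) :
    ∫ x, Real.exp (a * (m + x) ^ 2) ∂gaussianReal 0 1 =
      Real.exp (a * m ^ 2 / (1 - 2 * a)) / √(1 - 2 * a) := by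
  have h : 1 - 2 * a ≠ 0 := by linarith
  have hpos : 0 < 1 - 2 * a := by linarith
  rw [integral_gaussianReal_eq_integral_smul one_ne_zero]
  have key : ∀ x : ℝ, gaussianPDFReal 0 1 x • Real.exp (a * (m + x) ^ 2) =
      ((√(2 * Real.pi))⁻¹ * Real.exp (a * m ^ 2 / (1 - 2 * a))) *
        Real.exp (-(1 / 2 - a) * (x - 2 * a * m / (1 - 2 * a)) ^ 2) := by
    intro x
    simp only [gaussianPDFReal, NNReal.coe_one, mul_one, sub_zero, smul_eq_mul]
    rw [mul_assoc, mul_assoc, ← Real.exp_add, ← Real.exp_add]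
    congr 2
    field_simp
    ring
  simp_rw [key]
  rw [integral_const_mul,
    integral_sub_right_eq_self (fun x : ℝ => Real.exp (-(1 / 2 - a) * x ^ 2)),
    integral_gaussian, show Real.pi / (1 / 2 - a) = 2 * Real.pi / (1 - 2 * a) by
      rw [div_eq_div_iff (by linarith) h]; ring, Real.sqrt_div (by positivity)]
  have : √(2 * Real.pi) ≠ 0 := by positivity
  field_simp

theorem inv_one_sub_le_exp {x : ℝ} (hx : x ≤ 1 / 2) : (1 - x)⁻¹ ≤ Real.exp (x + x ^ 2) := by
  rw [inv_le_iff_one_le_mul₀ (by linarith)]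
  rcases le_total 0 x with h | h
  · have := Real.quadratic_le_exp_of_nonneg (x := x + x ^ 2) (by positivity)
    refine le_trans ?_ (mul_le_mul_of_nonneg_right this (by linarith))
    have : 0 ≤ x ^ 2 * ((1 - x) * (1 + x) ^ 2 - 2 * x) := by
      apply mul_nonneg (sq_nonneg _)
      nlinarith [mul_nonneg h h, mul_nonneg (mul_nonneg h h) (by linarith : 0 ≤ 1 / 2 - x),
        mul_nonneg h (by linarith : 0 ≤ 1 / 2 - x)]
    nlinarith
  · have := Real.add_one_le_exp (x + x ^ 2)
    refine le_trans ?_ (mul_le_mul_of_nonneg_right this (by linarith))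
    nlinarith [mul_nonneg (sq_nonneg x) (neg_nonneg.2 h)]

/-- The standard Gaussian measure is invariant under orthonormal changes of coordinates. -/
theorem integral_stdGaussian_orthonormalBasis {n : ℕ}
    (b : OrthonormalBasis (Fin n) ℝ (EuclideanSpace ℝ (Fin n)))
    {f : (Fin n → ℝ) → ℝ} (hf : Continuous f) :
    ∫ ε, f ε ∂stdGaussian n = ∫ x, f (∑ i, x i • ⇑(b i)) ∂stdGaussian n := by
  have h := (map_pi_eq_stdGaussian (ι := Fin n)).trans (stdGaussian_eq_map_pi_orthonormalBasis b)
  have h' := congrArg (fun ν => ∫ z, f (WithLp.ofLp z) ∂ν) h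
  have hc : Continuous fun z : EuclideanSpace ℝ (Fin n) => f (WithLp.ofLp z) := by fun_prop
  simp only at h'
  rw [integral_map (by fun_prop) hc.aestronglyMeasurable,
    integral_map (Continuous.aemeasurable (by fun_prop)) hc.aestronglyMeasurable] at h'
  simpa [_root_.stdGaussian] using h'

instance isProbabilityMeasure_stdGaussian_pi (n : ℕ) : IsProbabilityMeasure (stdGaussian n) := by
  unfold _root_.stdGaussian; infer_instance

theorem sqnorm_eq_dotProduct {n : ℕ} (v : Fin n → ℝ) : sqnorm v = v ⬝ᵥ v := by
  simp [sqnorm, dotProduct, sq]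

theorem Matrix.IsHermitian.dotProduct_mulVec_eq_sum {n : ℕ} {A : Matrix (Fin n) (Fin n) ℝ}
    (hA : A.IsHermitian) (v : Fin n → ℝ) :
    v ⬝ᵥ A *ᵥ v = ∑ i, hA.eigenvalues i * (⇑(hA.eigenvectorBasis i) ⬝ᵥ v) ^ 2 := by
  have h := hA.eigenvectorBasis.sum_inner_mul_inner (WithLp.toLp 2 v) (WithLp.toLp 2 (A *ᵥ v))
  simp only [EuclideanSpace.inner_eq_star_dotProduct, star_trivial] at h
  rw [dotProduct_comm, ← h]
  refine Finset.sum_congr rfl fun i _ => ?_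
  rw [dotProduct_comm (A *ᵥ v), dotProduct_mulVec, ← mulVec_transpose,
    ← conjTranspose_eq_transpose_of_trivial, hA.eq, hA.mulVec_eigenvectorBasis, smul_dotProduct,
    smul_eq_mul]
  ring

theorem Matrix.IsHermitian.sqnorm_mulVec_eq_sum {n : ℕ} {A : Matrix (Fin n) (Fin n) ℝ}
    (hA : A.IsHermitian) (v : Fin n → ℝ) :
    sqnorm (A *ᵥ v) = ∑ i, hA.eigenvalues i ^ 2 * (⇑(hA.eigenvectorBasis i) ⬝ᵥ v) ^ 2 := by
  have h := hA.eigenvectorBasis.sum_inner_mul_inner (WithLp.toLp 2 (A *ᵥ v))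
    (WithLp.toLp 2 (A *ᵥ v))
  simp only [EuclideanSpace.inner_eq_star_dotProduct, star_trivial] at h
  rw [sqnorm_eq_dotProduct, ← h]
  refine Finset.sum_congr rfl fun i _ => ?_
  rw [dotProduct_comm (A *ᵥ v), dotProduct_mulVec, ← mulVec_transpose,
    ← conjTranspose_eq_transpose_of_trivial, hA.eq, hA.mulVec_eigenvectorBasis, smul_dotProduct,
    smul_eq_mul]
  ring

theorem Matrix.IsHermitian.trace_mul_self_eq_sum {n : ℕ} {A : Matrix (Fin n) (Fin n) ℝ}
    (hA : A.IsHermitian) : (A * A).trace = ∑ i, hA.eigenvalues i ^ 2 := by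
  have h := hA.spectral_theorem
  have h2 : A * A = Unitary.conjStarAlgAut ℝ _ hA.eigenvectorUnitary
      (diagonal (RCLike.ofReal ∘ hA.eigenvalues) * diagonal (RCLike.ofReal ∘ hA.eigenvalues)) := by
    rw [map_mul, ← h]
  rw [h2, Unitary.conjStarAlgAut_apply, trace_mul_cycle, Unitary.coe_star_mul_self, one_mul,
    diagonal_mul_diagonal, trace_diagonal]
  simp [sq]

theorem integral_exp_quadratic_stdGaussian {n : ℕ} {A : Matrix (Fin n) (Fin n) ℝ}
    (hA : A.IsHermitian) (μ : Fin n → ℝ) {t : ℝ} (ht : ∀ i, hA.eigenvalues i * t < 1 / 2) :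
    ∫ ε, Real.exp (((μ + ε) ⬝ᵥ A *ᵥ (μ + ε)) * t) ∂stdGaussian n =
      ∏ i, Real.exp (hA.eigenvalues i * t * (⇑(hA.eigenvectorBasis i) ⬝ᵥ μ) ^ 2 /
        (1 - 2 * (hA.eigenvalues i * t))) / √(1 - 2 * (hA.eigenvalues i * t)) := by
  rw [integral_stdGaussian_orthonormalBasis hA.eigenvectorBasis (by fun_prop)]
  have horth (i : Fin n) (x : Fin n → ℝ) :
      ⇑(hA.eigenvectorBasis i) ⬝ᵥ (∑ j, x j • ⇑(hA.eigenvectorBasis j)) = x i := by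
    have h := hA.eigenvectorBasis.orthonormal.inner_right_fintype x i
    rw [EuclideanSpace.inner_eq_star_dotProduct, star_trivial, dotProduct_comm] at h
    simpa using h
  have key (x : Fin n → ℝ) : Real.exp
      (((μ + ∑ j, x j • ⇑(hA.eigenvectorBasis j)) ⬝ᵥ
        A *ᵥ (μ + ∑ j, x j • ⇑(hA.eigenvectorBasis j))) * t) =
      ∏ i, Real.exp (hA.eigenvalues i * t * (⇑(hA.eigenvectorBasis i) ⬝ᵥ μ + x i) ^ 2) := by
    rw [hA.dotProduct_mulVec_eq_sum, ← Real.exp_sum, Finset.sum_mul]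
    congr 1
    refine Finset.sum_congr rfl fun i _ => ?_
    rw [dotProduct_add, horth]
    ring
  simp_rw [key, _root_.stdGaussian]
  rw [integral_fintype_prod_eq_prod (f := fun i x => Real.exp
    (hA.eigenvalues i * t * (⇑(hA.eigenvectorBasis i) ⬝ᵥ μ + x) ^ 2))]
  exact Finset.prod_congr rfl fun i _ => integral_exp_mul_sq_gaussianReal _ _ (ht i)

theorem log_integral_exp_quadratic_le {n : ℕ} {A : Matrix (Fin n) (Fin n) ℝ}
    (hA : A.IsHermitian) (hA1 : ∀ i, hA.eigenvalues i ≤ 1) (μ : Fin n → ℝ) {t : ℝ}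
    (ht0 : 0 ≤ t) (ht : t ≤ 1 / 4) :
    Real.log (∫ ε, Real.exp (((μ + ε) ⬝ᵥ A *ᵥ (μ + ε)) * t) ∂stdGaussian n) ≤
      t * (μ ⬝ᵥ A *ᵥ μ) + 2 * t ^ 2 / (1 - 2 * t) * sqnorm (A *ᵥ μ) +
        t * A.trace + 2 * t ^ 2 * (A * A).trace := by
  have hle (i) : hA.eigenvalues i * t ≤ t := by nlinarith [hA1 i]
  rw [integral_exp_quadratic_stdGaussian hA μ fun i => by linarith [hle i],
    Real.log_prod fun i _ => by
      have : 0 < 1 - 2 * (hA.eigenvalues i * t) := by linarith [hle i]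
      positivity,
    hA.dotProduct_mulVec_eq_sum, hA.sqnorm_mulVec_eq_sum, hA.trace_mul_self_eq_sum,
    hA.trace_eq_sum_eigenvalues]
  simp only [Finset.mul_sum, ← Finset.sum_add_distrib]
  refine Finset.sum_le_sum fun i _ => ?_
  simp only [RCLike.ofReal_real_eq_id, id]
  set l := hA.eigenvalues i
  set m := ⇑(hA.eigenvectorBasis i) ⬝ᵥ μ
  have hl : l * t ≤ t := hle i
  have h1 : 0 < 1 - 2 * (l * t) := by linarith
  have h2 : 0 < 1 - 2 * t := by linarith
  rw [Real.log_div (by positivity) (by positivity), Real.log_exp, Real.log_sqrt h1.le]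
  have h3 : -Real.log (1 - 2 * (l * t)) ≤ 2 * (l * t) + (2 * (l * t)) ^ 2 := by
    rw [← Real.log_inv, Real.log_le_iff_le_exp (by positivity)]
    exact inv_one_sub_le_exp (by linarith)
  have h4 : l * t * m ^ 2 / (1 - 2 * (l * t)) ≤
      t * (l * m ^ 2) + 2 * t ^ 2 / (1 - 2 * t) * (l ^ 2 * m ^ 2) := by
    have e (q : ℝ) (hq : 1 - 2 * q ≠ 0) :
        q * m ^ 2 / (1 - 2 * q) = q * m ^ 2 + 2 * q ^ 2 * m ^ 2 / (1 - 2 * q) := by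
      rw [div_eq_iff hq, add_mul, div_mul_cancel₀ _ hq]
      ring
    rw [e _ h1.ne', div_mul_eq_mul_div,
      show 2 * (l * t) ^ 2 * m ^ 2 = 2 * t ^ 2 * (l ^ 2 * m ^ 2) by ring, mul_assoc l t,
      mul_left_comm l t]
    gcongr
  linarith

section Projection

variable {n p : ℕ} (X : Matrix (Fin n) (Fin p) ℝ) {F : Finset (Fin p)}

theorem linearIndependent_col_of_rank_eq_card {m : Type*} [Fintype m] {ι : Type*} [Fintype ι]
    {A : Matrix m ι ℝ} (h : A.rank = Fintype.card ι) : LinearIndependent ℝ A.col := by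
  rw [linearIndependent_iff_card_eq_finrank_span, Set.finrank, ← rank_eq_finrank_span_cols, h]

theorem rank_colSub_of_subset {S : Finset (Fin p)} (hS : S ⊆ F)
    (hF : (colSub X F).rank = F.card) : (colSub X S).rank = S.card := by
  have h := linearIndependent_col_of_rank_eq_card (A := colSub X F) (by simpa using hF)
  have h2 : LinearIndependent ℝ (colSub X S).col :=
    h.comp (fun j : {j // j ∈ S} => (⟨j, hS j.2⟩ : {j // j ∈ F})) fun a b hab =>
      Subtype.ext (congrArg (fun z : {j // j ∈ F} => (z : Fin p)) hab)
  rw [← rank_transpose]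
  simpa using h2.rank_matrix (M := (colSub X S)ᵀ)

theorem isUnit_gram_colSub (hF : (colSub X F).rank = F.card) :
    IsUnit ((colSub X F)ᵀ * colSub X F) := by
  rw [← linearIndependent_cols_iff_isUnit]
  exact linearIndependent_col_of_rank_eq_card (by simpa [rank_transpose_mul_self] using hF)

theorem proj_mul_colSub (hF : (colSub X F).rank = F.card) :
    proj X F * colSub X F = colSub X F := by
  have h := (isUnit_iff_isUnit_det _).1 (isUnit_gram_colSub X hF)
  rw [proj, Matrix.mul_assoc, Matrix.mul_assoc, nonsing_inv_mul _ h, Matrix.mul_one]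

theorem transpose_proj : (proj X F)ᵀ = proj X F := by
  simp [proj, transpose_mul, transpose_nonsing_inv, Matrix.mul_assoc]

theorem proj_mul_proj_of_subset {S : Finset (Fin p)} (hS : S ⊆ F)
    (hF : (colSub X F).rank = F.card) : proj X F * proj X S = proj X S := by
  have h : proj X F * colSub X S = colSub X S := by
    ext i j
    exact congrFun (congrFun (proj_mul_colSub X hF) i) ⟨j, hS j.2⟩
  rw [proj.eq_1 X S, ← Matrix.mul_assoc, ← Matrix.mul_assoc, h]

theorem proj_mul_proj_of_subset' {S : Finset (Fin p)} (hS : S ⊆ F)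
    (hF : (colSub X F).rank = F.card) : proj X S * proj X F = proj X S := by
  rw [← transpose_inj, transpose_mul, transpose_proj, transpose_proj,
    proj_mul_proj_of_subset X hS hF]

theorem trace_proj (hF : (colSub X F).rank = F.card) : (proj X F).trace = F.card := by
  have h := (isUnit_iff_isUnit_det _).1 (isUnit_gram_colSub X hF)
  rw [proj, trace_mul_comm, ← Matrix.mul_assoc, mul_nonsing_inv _ h]
  simp

theorem proj_mulVec_mulVec (hF : (colSub X F).rank = F.card) {γ : Fin p → ℝ}
    (hγ : ∀ i ∉ F, γ i = 0) : proj X F *ᵥ X *ᵥ γ = X *ᵥ γ := by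
  have h : X *ᵥ γ = colSub X F *ᵥ fun j => γ j := by
    ext i
    simp only [mulVec, dotProduct, colSub, submatrix_apply, id]
    rw [Finset.sum_coe_sort F fun j => X i j * γ j]
    exact (Finset.sum_subset (Finset.subset_univ F) fun j _ hj => by simp [hγ j hj]).symm
  rw [h, mulVec_mulVec, proj_mul_colSub X hF]

end Projection

theorem trace_mul_self_nonneg {n : ℕ} {B : Matrix (Fin n) (Fin n) ℝ} (hB : Bᵀ = B) :
    0 ≤ (B * B).trace := by
  nth_rewrite 1 [← hB]
  simp only [trace, diag_apply, mul_apply, transpose_apply]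
  exact Finset.sum_nonneg fun i _ => Finset.sum_nonneg fun j _ => mul_self_nonneg _

theorem sqnorm_mulVec_of_idempotent {n : ℕ} {P : Matrix (Fin n) (Fin n) ℝ} (hP : Pᵀ = P)
    (hPP : P * P = P) (v : Fin n → ℝ) : sqnorm (P *ᵥ v) = v ⬝ᵥ P *ᵥ v := by
  rw [sqnorm_eq_dotProduct, dotProduct_comm, dotProduct_mulVec, ← mulVec_transpose, hP,
    mulVec_mulVec, hPP, dotProduct_comm]

theorem sqnorm_nonneg {n : ℕ} (v : Fin n → ℝ) : 0 ≤ sqnorm v :=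
  Finset.sum_nonneg fun _ _ => sq_nonneg _

theorem eigenvalues_sub_le_one {n : ℕ} {P Q : Matrix (Fin n) (Fin n) ℝ}
    (hP : Pᵀ = P) (hPP : P * P = P) (hQ : Qᵀ = Q) (hQQ : Q * Q = Q)
    (hA : (P - Q).IsHermitian) (i : Fin n) : hA.eigenvalues i ≤ 1 := by
  rw [hA.eigenvalues_eq]
  simp only [star_trivial, RCLike.re_to_real]
  set v := ⇑(hA.eigenvectorBasis i)
  have hv : v ⬝ᵥ v = 1 := by
    have := real_inner_self_eq_norm_sq (hA.eigenvectorBasis i)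
    rw [hA.eigenvectorBasis.norm_eq_one, one_pow] at this
    rwa [EuclideanSpace.inner_eq_star_dotProduct, star_trivial] at this
  have h1 : sqnorm ((1 - P) *ᵥ v) = v ⬝ᵥ (1 - P) *ᵥ v :=
    sqnorm_mulVec_of_idempotent (by simp [hP]) (by simp [sub_mul, mul_sub, hPP]) v
  have h2 := sqnorm_mulVec_of_idempotent hQ hQQ v
  have h3 := sqnorm_nonneg ((1 - P) *ᵥ v)
  have h4 := sqnorm_nonneg (Q *ᵥ v)
  rw [h1, sub_mulVec, dotProduct_sub, one_mulVec, hv] at h3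
  rw [sub_mulVec, dotProduct_sub]
  linarith

theorem trace_sub_mul_sub_le {n p k : ℕ} (X : Matrix (Fin n) (Fin p) ℝ) (T F : Finset (Fin p))
    (hT : T.card = k) (hF : F.card = k) (hrF : (colSub X F).rank = k)
    (hrT : (colSub X T).rank = k) :
    ((proj X F - proj X T) * (proj X F - proj X T)).trace ≤ 4 * ((T \ F).card : ℝ) := by
  rw [← hF] at hrF
  rw [← hT] at hrT
  have hR := rank_colSub_of_subset X (Finset.inter_subset_left (s₁ := T) (s₂ := F)) hrT
  have h1 := proj_mul_proj_of_subset X (Finset.inter_subset_left (s₁ := T) (s₂ := F)) hrT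
  have h2 := proj_mul_proj_of_subset X (Finset.inter_subset_right (s₁ := T) (s₂ := F)) hrF
  have h1' := proj_mul_proj_of_subset' X (Finset.inter_subset_left (s₁ := T) (s₂ := F)) hrT
  have h2' := proj_mul_proj_of_subset' X (Finset.inter_subset_right (s₁ := T) (s₂ := F)) hrF
  have hPP := proj_mul_proj_of_subset X subset_rfl hrF
  have hQQ := proj_mul_proj_of_subset X subset_rfl hrT
  have hRR := proj_mul_proj_of_subset X subset_rfl hR
  have tP := trace_proj X hrF
  have tQ := trace_proj X hrT
  have tR := trace_proj X hR
  have hnn := trace_mul_self_nonneg (B := proj X F + proj X T - (2 : ℝ) • proj X (T ∩ F))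
    (by simp [transpose_proj])
  have hcard : ((T \ F).card : ℝ) + ((T ∩ F).card : ℝ) = k := by
    rw [← hT]; exact_mod_cast Finset.card_sdiff_add_card_inter T F
  simp only [add_mul, mul_add, sub_mul, mul_sub, hPP, hQQ, hRR, h1, h2, h1', h2', smul_mul,
    Matrix.mul_smul, trace_add, trace_sub, trace_smul, tP, tQ, tR, hT, hF, smul_eq_mul] at hnn ⊢
  linarith

theorem bddBelow_log_integral_exp_mul {Ω : Type*} [MeasurableSpace Ω] (ν : Measure Ω)
    [IsProbabilityMeasure ν] {Z : Ω → ℝ} (hZ : Measurable Z) :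
    BddBelow (Set.range fun t : {t : ℝ // |t| < 1 / 2} =>
      Real.log (∫ ω, Real.exp (Z ω * t.1) ∂ν)) := by
  have hint : Integrable (fun ω => Real.exp (-|Z ω| / 2)) ν := by
    refine Integrable.of_bound (by fun_prop) 1 (.of_forall fun ω => ?_)
    rw [Real.norm_eq_abs, Real.abs_exp, Real.exp_le_one_iff]
    linarith [abs_nonneg (Z ω)]
  refine ⟨min 0 (Real.log (∫ ω, Real.exp (-|Z ω| / 2) ∂ν)), ?_⟩
  rintro _ ⟨⟨t, ht⟩, rfl⟩
  by_cases h : Integrable (fun ω => Real.exp (Z ω * t)) ν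
  · refine (min_le_right _ _).trans (Real.log_le_log (integral_exp_pos hint) ?_)
    refine integral_mono hint h fun ω => Real.exp_le_exp.2 ?_
    have h1 := neg_abs_le (Z ω * t)
    rw [abs_mul] at h1
    nlinarith [abs_nonneg (Z ω)]
  · simp [integral_undef h]

/-- For `y ∼ N(X_T β_T, I_n)`, `Z = yᵀ(Π_F - Π_T)y` and
`d = |T ∖ F|`, the infimum over `|t| < 1/2` of `log E[e^{Zt}]` is at most
`d/2 - ((3 - 2√2)/2) ‖(I - Π_F) X_{T∖F} β_{T∖F}‖²`. -/
theorem inf_log_mgf_bound {n p k : ℕ}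
    (X : Matrix (Fin n) (Fin p) ℝ) (T F : Finset (Fin p))
    (hT : T.card = k) (hF : F.card = k)
    (hrF : (colSub X F).rank = k) (hrT : (colSub X T).rank = k)
    (β : Fin p → ℝ) (hβ : ∀ i ∉ T, β i = 0)
    (d : ℕ) (hd : d = (T \ F).card) :
    (⨅ t : {t : ℝ // |t| < 1 / 2},
        Real.log (∫ ε, Real.exp
          (((X.mulVec β + ε) ⬝ᵥ
              (proj X F - proj X T).mulVec (X.mulVec β + ε)) * t.1)
          ∂ stdGaussian n)) ≤
      (d : ℝ) / 2 - (3 - 2 * Real.sqrt 2) / 2 *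
        sqnorm ((1 - proj X F).mulVec (X.mulVec (restr β (T \ F)))) := by
  subst hd
  have hF' : (colSub X F).rank = F.card := hrF.trans hF.symm
  have hT' : (colSub X T).rank = T.card := hrT.trans hT.symm
  have hPP := proj_mul_proj_of_subset X subset_rfl hF'
  have hQQ := proj_mul_proj_of_subset X subset_rfl hT'
  have hP := transpose_proj X (F := F)
  have hQ := transpose_proj X (F := T)
  have hA : (proj X F - proj X T).IsHermitian := by
    rw [IsHermitian, conjTranspose_eq_transpose_of_trivial, transpose_sub, hP, hQ]
  have hQμ : proj X T *ᵥ X *ᵥ β = X *ᵥ β := proj_mulVec_mulVec X hT' hβ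
  have hsplit : (1 - proj X F) *ᵥ X *ᵥ restr β (T \ F) = (1 - proj X F) *ᵥ X *ᵥ β := by
    have hz : (1 - proj X F) *ᵥ X *ᵥ restr β (T ∩ F) = 0 := by
      rw [sub_mulVec, one_mulVec, proj_mulVec_mulVec X hF' fun i hi => by simp [restr, hi],
        sub_self]
    have hb : β = restr β (T \ F) + restr β (T ∩ F) := by
      ext i
      by_cases h1 : i ∈ T <;> by_cases h2 : i ∈ F <;> simp [restr, h1, h2, hβ]
    conv_rhs => rw [hb, mulVec_add, mulVec_add, hz, add_zero]
  rw [hsplit]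
  set μ := X *ᵥ β
  have hμA : (proj X F - proj X T) *ᵥ μ = -((1 - proj X F) *ᵥ μ) := by
    rw [sub_mulVec, sub_mulVec, hQμ, one_mulVec, neg_sub]
  have hsq : sqnorm ((1 - proj X F) *ᵥ μ) = μ ⬝ᵥ (1 - proj X F) *ᵥ μ :=
    sqnorm_mulVec_of_idempotent (by simp [hP]) (by simp [sub_mul, mul_sub, hPP]) μ
  have hlin : μ ⬝ᵥ (proj X F - proj X T) *ᵥ μ = -sqnorm ((1 - proj X F) *ᵥ μ) := by
    rw [hμA, hsq, dotProduct_neg]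
  have hquad : sqnorm ((proj X F - proj X T) *ᵥ μ) = sqnorm ((1 - proj X F) *ᵥ μ) := by
    rw [hμA]; simp [sqnorm]
  have htr : (proj X F - proj X T).trace = 0 := by
    rw [trace_sub, trace_proj X hF', trace_proj X hT', hF, hT, sub_self]
  have hs2 : √2 * √2 = (2 : ℝ) := Real.mul_self_sqrt (by norm_num)
  have hs_lo : (1.4 : ℝ) ≤ √2 := Real.le_sqrt_of_sq_le (by norm_num)
  have hs_hi : √2 ≤ (1.5 : ℝ) := Real.sqrt_le_iff.2 (by norm_num)
  have ht : |(2 - √2) / 4| < 1 / 2 := by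
    rw [abs_lt]; constructor <;> linarith
  refine (ciInf_le (bddBelow_log_integral_exp_mul _ (Continuous.measurable (by fun_prop)))
    ⟨(2 - √2) / 4, ht⟩).trans ?_
  refine (log_integral_exp_quadratic_le hA (eigenvalues_sub_le_one hP hPP hQ hQQ hA) μ
    (by linarith) (by linarith)).trans ?_
  have htr2 := trace_sub_mul_sub_le X T F hT hF hrF hrT
  rw [hlin, hquad, htr]
  set S := sqnorm ((1 - proj X F) *ᵥ μ)
  have hcoef : 2 * ((2 - √2) / 4) ^ 2 / (1 - 2 * ((2 - √2) / 4)) =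
      (2 - √2) / 4 - (3 - 2 * √2) / 2 := by
    rw [div_eq_iff (by linarith)]
    nlinarith
  have hd : 2 * ((2 - √2) / 4) ^ 2 * ((proj X F - proj X T) * (proj X F - proj X T)).trace ≤
      ((T \ F).card : ℝ) / 2 := by
    have h1 : 2 * ((2 - √2) / 4) ^ 2 ≤ 1 / 8 := by nlinarith
    have h2 := mul_le_mul_of_nonneg_left htr2 (by positivity : 0 ≤ 2 * ((2 - √2) / 4) ^ 2)
    have h3 := mul_le_mul_of_nonneg_right h1
      (by positivity : (0 : ℝ) ≤ 4 * ((T \ F).card : ℝ))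
    linarith
  rw [hcoef]
  linarith

end
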